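/- Let k ≥ 3 be an integer. Suppose that for every set of k−1 distinct positive integers u₁, …, u_{k−1} there exists a real number t with ‖t·uᵢ‖ ≥ 1/k for all i. Let p be a positive integer. Say that an integer v covers an integer j if ‖j·v/((k+1)p)‖ < 1/(k+1). Suppose there is NO k-tuple v₁, …, v_k of integers from {1, …, ⌊(k+1)p/2⌋}, none divisible by p, such that (i) for every subset S of {v₁, …, v_k} of size k−1 one has gcd(S ∪ {(k+1)p}) = 1, and (ii) every j ∈ {1, …, ⌊(k+1)p/2⌋} is covered by at least one vᵢ. Then for every set {w₁, …, w_k} of k distinct positive integers for which there is no real t with ‖t·wᵢ‖ ≥ 1/(k+1) for all i, p divides the product w₁·w₂·⋯·w_k. -/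

import Mathlib

/-- The distance from a real number to the nearest integer. -/
noncomputable def nearestDist (x : ℝ) : ℝ := ⨅ n : ℤ, |x - n|

/-- Given `k` and `p`, the integer `v` covers the integer `j` if
`‖j v / ((k+1) p)‖ < 1/(k+1)`. -/
noncomputable def covers (k p v j : ℕ) : Prop :=
  nearestDist (((j * v : ℕ) : ℝ) / ((k + 1) * p)) < 1 / (k + 1)

theorem nearestDist_ge_iff {c x : ℝ} : nearestDist x ≥ c ↔ ∀ n : ℤ, c ≤ |x - n| :=
  le_ciInf_iff ⟨0, by rintro _ ⟨n, rfl⟩; exact abs_nonneg _⟩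

theorem nearestDist_add_intCast (x : ℝ) (z : ℤ) : nearestDist (x + z) = nearestDist x := by
  refine eq_of_forall_le_iff fun c => ?_
  change nearestDist (x + z) ≥ c ↔ nearestDist x ≥ c
  rw [nearestDist_ge_iff, nearestDist_ge_iff]
  constructor
  · intro h n
    have := h (n + z)
    push_cast at this
    rwa [add_sub_add_right_eq_sub] at this
  · intro h n
    have := h (n - z)
    push_cast at this
    rwa [show x - ((n : ℝ) - z) = x + z - n by ring] at this

theorem nearestDist_neg (x : ℝ) : nearestDist (-x) = nearestDist x := by
  refine eq_of_forall_le_iff fun c => ?_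
  change nearestDist (-x) ≥ c ↔ nearestDist x ≥ c
  rw [nearestDist_ge_iff, nearestDist_ge_iff]
  constructor
  · intro h n
    have := h (-n)
    push_cast at this
    rwa [← abs_neg, show -(-x - -(n : ℝ)) = x - n by ring] at this
  · intro h n
    have := h (-n)
    push_cast at this
    rwa [← abs_neg, show -(x - -(n : ℝ)) = -x - n by ring] at this

theorem le_nearestDist_of_mem_Icc {c x : ℝ} (hx : x ∈ Set.Icc c (1 - c)) :
    nearestDist x ≥ c := by
  rw [nearestDist_ge_iff]
  intro n
  obtain ⟨h₁, h₂⟩ := hx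
  rcases le_or_gt n 0 with hn | hn
  · have : (n : ℝ) ≤ 0 := by exact_mod_cast hn
    exact le_trans (by linarith) (le_abs_self _)
  · have : (1 : ℝ) ≤ n := by exact_mod_cast hn
    exact le_trans (by linarith) (neg_le_abs _)

/-- Some translate of `y` by a multiple of `1 / d` is at distance at least `c` from `ℤ`,
provided `d ≥ 2` and `c ≤ 1 / 4`. -/
theorem exists_nearestDist_add_div_ge {c : ℝ} (hc : c ≤ 1 / 4) {d : ℕ} (hd : 2 ≤ d) (y : ℝ) :
    ∃ r : ℤ, nearestDist (y + r / d) ≥ c := by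
  have hd' : (2 : ℝ) ≤ d := by exact_mod_cast hd
  have hd0 : (0 : ℝ) < d := by linarith
  refine ⟨⌈(c - y) * d⌉, le_nearestDist_of_mem_Icc ⟨?_, ?_⟩⟩
  · have : c - y ≤ ⌈(c - y) * d⌉ / d := (le_div_iff₀ hd0).2 (Int.le_ceil _)
    linarith
  · have : (⌈(c - y) * d⌉ : ℝ) / d ≤ 1 - c - y := by
      rw [div_le_iff₀ hd0]
      have := Int.ceil_lt_add_one ((c - y) * d)
      nlinarith
    linarith

/-- If the speeds outside the index `a` can be kept at distance `c ≤ 1 / 4` from `ℤ` and share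
a common factor `d ≥ 2` coprime to the speed `w a`, then all speeds can. -/
theorem exists_nearestDist_ge_of_coprime {ι : Type*} {w : ι → ℕ} {a : ι} {d : ℕ} {c t : ℝ}
    (hc : c ≤ 1 / 4) (hd : 2 ≤ d) (hdvd : ∀ i, i ≠ a → d ∣ w i) (hcop : Nat.Coprime (w a) d)
    (ht : ∀ i, i ≠ a → nearestDist (t * w i) ≥ c) :
    ∃ t : ℝ, ∀ i, nearestDist (t * w i) ≥ c := by
  obtain ⟨r, hr⟩ := exists_nearestDist_add_div_ge hc hd (t * w a)
  obtain ⟨m, q, hmq⟩ := Nat.isCoprime_iff_coprime.2 hcop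
  have hmq' : (m : ℝ) * w a + q * d = 1 := by exact_mod_cast hmq
  have hd0 : (d : ℝ) ≠ 0 := by
    have : d ≠ 0 := by omega
    exact_mod_cast this
  refine ⟨t + r * m / d, fun i => ?_⟩
  by_cases hi : i = a
  · subst hi
    have : (t + r * m / d) * w i = t * w i + r / d + ((-(r * q) : ℤ) : ℝ) := by
      push_cast
      field_simp
      linear_combination (r : ℝ) * hmq'
    rwa [this, nearestDist_add_intCast]
  · obtain ⟨e, he⟩ := hdvd i hi
    have : (t + r * m / d) * w i = t * w i + ((r * m * e : ℤ) : ℝ) := by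
      rw [he]
      push_cast
      field_simp
    rw [this, nearestDist_add_intCast]
    exact ht i hi

theorem exists_le_half_intCast_eq {N w : ℕ} (hN : 0 < N) (h : ¬ N ∣ w) :
    ∃ v : ℕ, (1 ≤ v ∧ v ≤ N / 2) ∧
      ∃ z : ℤ, (v : ℤ) = w + z * N ∨ (v : ℤ) = -(w + z * N) := by
  have hlt := Nat.mod_lt w hN
  have h0 : w % N ≠ 0 := fun h0 => h (Nat.dvd_of_mod_eq_zero h0)
  have hw : ((w % N : ℕ) : ℤ) = w - N * ((w / N : ℕ) : ℤ) := by
    have : ((w % N + N * (w / N) : ℕ) : ℤ) = w := by rw [Nat.mod_add_div]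
    push_cast at this ⊢
    linarith
  rcases le_or_gt (w % N) (N / 2) with hle | hgt
  · exact ⟨w % N, ⟨by omega, hle⟩, -((w / N : ℕ) : ℤ), Or.inl (by rw [hw]; ring)⟩
  · refine ⟨N - w % N, ⟨by omega, by omega⟩, -((w / N : ℕ) : ℤ) - 1, Or.inr ?_⟩
    rw [Nat.cast_sub hlt.le, hw]
    ring

theorem dvd_iff_of_intCast_eq {N w v d : ℕ} {z : ℤ} (hd : d ∣ N)
    (h : (v : ℤ) = w + z * N ∨ (v : ℤ) = -(w + z * N)) : d ∣ v ↔ d ∣ w := by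
  have hN : (d : ℤ) ∣ z * N := (Int.natCast_dvd_natCast.2 hd).mul_left z
  rw [← Int.natCast_dvd_natCast, ← Int.natCast_dvd_natCast]
  rcases h with h | h
  · rw [h, Int.dvd_add_left hN]
  · rw [h, Int.dvd_neg, Int.dvd_add_left hN]

theorem nearestDist_mul_div_of_intCast_eq {N w v : ℕ} {z : ℤ} (hN : 0 < N) (j : ℕ)
    (h : (v : ℤ) = w + z * N ∨ (v : ℤ) = -(w + z * N)) :
    nearestDist (((j * v : ℕ) : ℝ) / N) = nearestDist ((j : ℝ) / N * w) := by
  have hN' : (N : ℝ) ≠ 0 := by exact_mod_cast hN.ne'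
  have key : (j : ℝ) * (w + z * N) / N = j / N * w + ((j * z : ℤ) : ℝ) := by
    push_cast
    field_simp
  rcases h with h | h
  · have h' : (v : ℝ) = w + z * N := by exact_mod_cast h
    rw [Nat.cast_mul, h', key, nearestDist_add_intCast]
  · have h' : (v : ℝ) = -(w + z * N) := by exact_mod_cast h
    rw [Nat.cast_mul, h', mul_neg, neg_div, nearestDist_neg, key, nearestDist_add_intCast]

/-- If speeds with gcd `1` do not have the lonely runner property, then any `k - 1` of them
have gcd `1`, provided the lonely runner conjecture holds for `k - 1` speeds. -/
theorem gcd_eq_one_of_card_eq_pred {k : ℕ} (hk : 3 ≤ k)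
    (H : ∀ u : Fin (k - 1) → ℕ, (∀ i, 0 < u i) → Function.Injective u →
      ∃ t : ℝ, ∀ i, nearestDist (t * u i) ≥ 1 / k)
    {w : Fin k → ℕ} (hpos : ∀ i, 0 < w i) (hinj : Function.Injective w)
    (hgcd : Finset.univ.gcd w = 1)
    (hnoLR : ¬ ∃ t : ℝ, ∀ i, nearestDist (t * w i) ≥ 1 / (k + 1))
    {S : Finset (Fin k)} (hS : S.card = k - 1) : S.gcd w = 1 := by
  by_contra hne
  have hk' : (3 : ℝ) ≤ k := by exact_mod_cast hk
  obtain ⟨a, ha⟩ : ∃ a, Sᶜ = {a} := by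
    rw [← Finset.card_eq_one, Finset.card_compl, Fintype.card_fin, hS]
    omega
  have hmem : ∀ i, i ≠ a → i ∈ S := fun i hi => by
    by_contra h
    exact hi (Finset.mem_singleton.1 (ha ▸ Finset.mem_compl.2 h))
  have hS0 : S.gcd w ≠ 0 := by
    intro h0
    obtain ⟨i, hi⟩ : S.Nonempty := Finset.card_pos.1 (by omega)
    exact (hpos i).ne' (Finset.gcd_eq_zero_iff.1 h0 i hi)
  have hdvd : ∀ i, i ≠ a → S.gcd w ∣ w i := fun i hi => Finset.gcd_dvd (hmem i hi)
  obtain ⟨t, ht⟩ := H (fun i => w (S.orderEmbOfFin hS i)) (fun _ => hpos _)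
    (hinj.comp (S.orderEmbOfFin hS).injective)
  refine hnoLR (exists_nearestDist_ge_of_coprime (a := a) (d := S.gcd w) (t := t) ?_ (by omega)
    hdvd ?_ ?_)
  · exact one_div_le_one_div_of_le (by norm_num) (by linarith)
  · refine Nat.dvd_one.1 (hgcd ▸ Finset.dvd_gcd fun i _ => ?_)
    by_cases hi : i = a
    · exact hi ▸ Nat.gcd_dvd_left _ _
    · exact (Nat.gcd_dvd_right _ _).trans (hdvd i hi)
  · intro i hi
    obtain ⟨b, rfl⟩ : i ∈ Set.range (S.orderEmbOfFin hS) := by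
      rw [Finset.range_orderEmbOfFin]
      exact hmem i hi
    exact le_trans (one_div_le_one_div_of_le (by linarith) (by linarith)) (ht b)

/-- `dvd_prod_of_no_bad_cover` for speeds with gcd `1`. -/
theorem dvd_prod_of_no_bad_cover_of_gcd_eq_one {k : ℕ} (hk : 3 ≤ k)
    (H : ∀ u : Fin (k - 1) → ℕ, (∀ i, 0 < u i) → Function.Injective u →
      ∃ t : ℝ, ∀ i, nearestDist (t * u i) ≥ 1 / k)
    {p : ℕ} (hp : 0 < p)
    (hcond : ¬ ∃ v : Fin k → ℕ,
      (∀ i, 1 ≤ v i ∧ v i ≤ (k + 1) * p / 2) ∧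
      (∀ i, ¬ p ∣ v i) ∧
      (∀ S : Finset (Fin k), S.card = k - 1 → Nat.gcd (S.gcd v) ((k + 1) * p) = 1) ∧
      (∀ j : ℕ, 1 ≤ j → j ≤ (k + 1) * p / 2 → ∃ i, covers k p (v i) j))
    {w : Fin k → ℕ} (hpos : ∀ i, 0 < w i) (hinj : Function.Injective w)
    (hgcd : Finset.univ.gcd w = 1)
    (hnoLR : ¬ ∃ t : ℝ, ∀ i, nearestDist (t * w i) ≥ 1 / (k + 1)) :
    p ∣ ∏ i, w i := by
  by_contra hprod
  have hpw : ∀ i, ¬ p ∣ w i := fun i hi =>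
    hprod (hi.trans (Finset.dvd_prod_of_mem w (Finset.mem_univ i)))
  have hN : 0 < (k + 1) * p := by positivity
  have hpN : p ∣ (k + 1) * p := dvd_mul_left _ _
  choose v hv z hz using fun i =>
    exists_le_half_intCast_eq hN fun h => hpw i (hpN.trans h)
  refine hcond ⟨v, hv, fun i h => hpw i ((dvd_iff_of_intCast_eq hpN (hz i)).1 h),
    fun S hS => ?_, fun j _ _ => ?_⟩
  · refine Nat.dvd_one.1 (Dvd.dvd.trans ?_
      (gcd_eq_one_of_card_eq_pred hk H hpos hinj hgcd hnoLR hS).dvd)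
    exact Finset.dvd_gcd fun i hi => (dvd_iff_of_intCast_eq (Nat.gcd_dvd_right _ _) (hz i)).1
      ((Nat.gcd_dvd_left _ _).trans (Finset.gcd_dvd hi))
  · by_contra! hj
    refine hnoLR ⟨(j : ℝ) / ((k + 1) * p : ℕ), fun i => ?_⟩
    rw [← nearestDist_mul_div_of_intCast_eq hN j (hz i)]
    have := not_lt.1 (hj i)
    push_cast at this ⊢
    exact this

/-- Reformulation of the main lemma in terms of covers: let `k ≥ 3`, suppose the lonely
runner conjecture holds for `k - 1` speeds, and let `p > 0`.  Suppose there is no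
`k`-tuple `v₁, …, v_k` of integers from `{1, …, ⌊(k+1)p/2⌋}`, none divisible by `p`,
such that every `(k-1)`-element subset of indices has `gcd(S ∪ {(k+1)p}) = 1` and
`{v₁, …, v_k}` covers all of `{1, …, ⌊(k+1)p/2⌋}`.  Then `p` divides the product of the
speeds of any set of `k` distinct positive integers without the lonely runner
property. -/
theorem dvd_prod_of_no_bad_cover (k : ℕ) (hk : 3 ≤ k)
    (H : ∀ u : Fin (k - 1) → ℕ, (∀ i, 0 < u i) → Function.Injective u →
      ∃ t : ℝ, ∀ i, nearestDist (t * u i) ≥ 1 / k)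
    (p : ℕ) (hp : 0 < p)
    (hcond : ¬ ∃ v : Fin k → ℕ,
      (∀ i, 1 ≤ v i ∧ v i ≤ (k + 1) * p / 2) ∧
      (∀ i, ¬ p ∣ v i) ∧
      (∀ S : Finset (Fin k), S.card = k - 1 → Nat.gcd (S.gcd v) ((k + 1) * p) = 1) ∧
      (∀ j : ℕ, 1 ≤ j → j ≤ (k + 1) * p / 2 → ∃ i, covers k p (v i) j))
    (w : Fin k → ℕ) (hpos : ∀ i, 0 < w i) (hinj : Function.Injective w)
    (hnoLR : ¬ ∃ t : ℝ, ∀ i, nearestDist (t * w i) ≥ 1 / (k + 1)) :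
    p ∣ ∏ i, w i := by
  set g := Finset.univ.gcd w
  have hdvd : ∀ i, g ∣ w i := fun i => Finset.gcd_dvd (Finset.mem_univ i)
  have hmul : ∀ i, w i / g * g = w i := fun i => Nat.div_mul_cancel (hdvd i)
  have hg0 : 0 < g := Nat.pos_of_dvd_of_pos (hdvd ⟨0, by omega⟩) (hpos _)
  refine (dvd_prod_of_no_bad_cover_of_gcd_eq_one hk H hp hcond (w := fun i => w i / g)
    (fun i => Nat.div_pos (Nat.le_of_dvd (hpos i) (hdvd i)) hg0) (fun i j hij => hinj ?_)
    (Finset.gcd_div_eq_one (Finset.mem_univ ⟨0, by omega⟩) (hpos _).ne') ?_).trans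
    (Finset.prod_dvd_prod_of_dvd _ _ fun i _ => Nat.div_dvd_of_dvd (hdvd i))
  · rw [← hmul i, ← hmul j]
    exact congrArg (· * g) hij
  · rintro ⟨t, ht⟩
    refine hnoLR ⟨t / g, fun i => ?_⟩
    have hgR : (g : ℝ) ≠ 0 := by exact_mod_cast hg0.ne'
    have : t / g * w i = t * (w i / g : ℕ) := by
      rw [Nat.cast_div (hdvd i) hgR]
      ring
    rw [this]
    exact ht i
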